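/- If the 4×4 matrix A (as defined) is positive semidefinite and all four quantities y₁ := 2Re(x·ȳ·t), y₂ := 2Re(x·u·z̄), y₃ := 2Re(y·w·z̄), y₄ := 2Re(t·w·ū) are negative, then [per(A)]² ≥ per(A∘Ā), where Ā is the entrywise complex conjugate of A and A∘Ā is the Hadamard (entrywise) product. -/

import Mathlib

open Matrix Complex ComplexOrder

/-- Expansion of the permanent along column `0`; the rows of each minor appear in the order given
by `Equiv.Perm.decomposeFin`. -/
theorem permanent_succ_column_zero {R : Type*} [CommRing R] {n : ℕ}
    (M : Matrix (Fin (n + 1)) (Fin (n + 1)) R) :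
    M.permanent =
      ∑ i, M i 0 * (M.submatrix (fun j => Equiv.swap 0 i j.succ) Fin.succ).permanent := by
  simp only [permanent, Finset.mul_sum]
  rw [← Equiv.Perm.decomposeFin.symm.sum_comp, Fintype.sum_prod_type]
  simp [Fin.prod_univ_succ]

/-- The permanent of a `4 × 4` matrix, written out. -/
theorem permanent_fin_four {R : Type*} [CommRing R] (M : Matrix (Fin 4) (Fin 4) R) :
    M.permanent =
      M 0 0 * M 1 1 * M 2 2 * M 3 3 + M 0 0 * M 1 1 * M 2 3 * M 3 2 +
      M 0 0 * M 1 2 * M 2 1 * M 3 3 + M 0 0 * M 1 2 * M 2 3 * M 3 1 +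
      M 0 0 * M 1 3 * M 2 1 * M 3 2 + M 0 0 * M 1 3 * M 2 2 * M 3 1 +
      M 0 1 * M 1 0 * M 2 2 * M 3 3 + M 0 1 * M 1 0 * M 2 3 * M 3 2 +
      M 0 1 * M 1 2 * M 2 0 * M 3 3 + M 0 1 * M 1 2 * M 2 3 * M 3 0 +
      M 0 1 * M 1 3 * M 2 0 * M 3 2 + M 0 1 * M 1 3 * M 2 2 * M 3 0 +
      M 0 2 * M 1 0 * M 2 1 * M 3 3 + M 0 2 * M 1 0 * M 2 3 * M 3 1 +
      M 0 2 * M 1 1 * M 2 0 * M 3 3 + M 0 2 * M 1 1 * M 2 3 * M 3 0 +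
      M 0 2 * M 1 3 * M 2 0 * M 3 1 + M 0 2 * M 1 3 * M 2 1 * M 3 0 +
      M 0 3 * M 1 0 * M 2 1 * M 3 2 + M 0 3 * M 1 0 * M 2 2 * M 3 1 +
      M 0 3 * M 1 1 * M 2 0 * M 3 2 + M 0 3 * M 1 1 * M 2 2 * M 3 0 +
      M 0 3 * M 1 2 * M 2 0 * M 3 1 + M 0 3 * M 1 2 * M 2 1 * M 3 0 := by
  simp only [permanent_succ_column_zero, permanent_isEmpty, Fin.sum_univ_succ,
    Fin.sum_univ_zero, submatrix_apply]
  simp [Equiv.swap_apply_def, Fin.ext_iff]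
  ring

/-- A `3 × 3` complex correlation matrix with nonpositive triangle term has squared
off-diagonal moduli of sum at most `1`. -/
theorem normSq_add_le_one_of_posSemidef {x y t : ℂ}
    (h : PosSemidef !![1, x, y; (starRingEnd ℂ) x, 1, t; (starRingEnd ℂ) y, (starRingEnd ℂ) t, 1])
    (hneg : (x * (starRingEnd ℂ) y * t).re ≤ 0) :
    ‖x‖ ^ 2 + ‖y‖ ^ 2 + ‖t‖ ^ 2 ≤ 1 := by
  have hd := (Complex.le_def.mp h.det_nonneg).1
  simp [det_fin_three] at hd hneg
  simp only [← Complex.normSq_eq_norm_sq, Complex.normSq_apply]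
  nlinarith

/-- Bound for the sum of the triangle terms of a lightly weighted complete graph on four
vertices. -/
theorem triangle_sum_le {a b c t u f : ℝ} (ha : 0 ≤ a) (hf : 0 ≤ f)
    (hS : a ^ 2 + b ^ 2 + c ^ 2 + t ^ 2 + u ^ 2 + f ^ 2 ≤ 27 / 32) :
    4 * (a * b * t + a * u * c + b * f * c + t * f * u) ≤
      a ^ 2 + b ^ 2 + c ^ 2 + t ^ 2 + u ^ 2 + f ^ 2 := by
  have h1 : 2 * (a * b * t + a * u * c + b * f * c + t * f * u) ≤
      (a + f) * (b ^ 2 + c ^ 2 + t ^ 2 + u ^ 2) := by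
    nlinarith [mul_nonneg ha (sq_nonneg (b - t)), mul_nonneg ha (sq_nonneg (u - c)),
      mul_nonneg hf (sq_nonneg (b - c)), mul_nonneg hf (sq_nonneg (t - u))]
  have h2 : b ^ 2 + c ^ 2 + t ^ 2 + u ^ 2 ≤
      (a ^ 2 + b ^ 2 + c ^ 2 + t ^ 2 + u ^ 2 + f ^ 2) - (a + f) ^ 2 / 2 := by
    nlinarith [sq_nonneg (a - f)]
  have hs := add_nonneg ha hf
  have h3 := h1.trans (mul_le_mul_of_nonneg_left h2 hs)
  have hS0 : 0 ≤ a ^ 2 + b ^ 2 + c ^ 2 + t ^ 2 + u ^ 2 + f ^ 2 := by positivity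
  generalize a ^ 2 + b ^ 2 + c ^ 2 + t ^ 2 + u ^ 2 + f ^ 2 = S at *
  generalize a + f = s at *
  suffices s * (S - s ^ 2 / 2) ≤ S / 2 by linarith
  rcases le_total s (1 / 2) with h | h
  · nlinarith [mul_nonneg hS0 (sub_nonneg.2 h), pow_nonneg hs 3]
  · nlinarith [mul_nonneg (sub_nonneg.2 h) (sub_nonneg.2 hS),
      mul_nonneg (sq_nonneg (s - 3 / 4)) (by linarith : 0 ≤ s + 3 / 2)]

/-- Bound for the sum of the four-cycle terms of a weighted complete graph on four vertices. -/
theorem four_cycle_sum_le (a b c t u f : ℝ) :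
    a * t * f * c + a * u * f * b + b * t * u * c ≤
      (a ^ 2 + b ^ 2 + c ^ 2 + t ^ 2 + u ^ 2 + f ^ 2) ^ 2 / 12 := by
  have h1 : |a * f + b * u + c * t| ≤
      (a ^ 2 + b ^ 2 + c ^ 2 + t ^ 2 + u ^ 2 + f ^ 2) / 2 := by
    rw [abs_le]
    constructor <;> nlinarith [sq_nonneg (a - f), sq_nonneg (b - u), sq_nonneg (c - t),
      sq_nonneg (a + f), sq_nonneg (b + u), sq_nonneg (c + t)]
  have h2 := pow_le_pow_left₀ (abs_nonneg _) h1 2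
  rw [sq_abs] at h2
  nlinarith [sq_nonneg (a * f - b * u), sq_nonneg (a * f - c * t), sq_nonneg (b * u - c * t)]

/-- Upper bound for the permanent of a symmetric `4 × 4` matrix with unit diagonal and
off-diagonal entries in `[0, 1]`. -/
theorem permanent_unit_diagonal_le {a b c t u f : ℝ}
    (ha : 0 ≤ a) (hb : 0 ≤ b) (hc : 0 ≤ c) (ht : 0 ≤ t) (hu : 0 ≤ u) (hf : 0 ≤ f)
    (ha1 : a ≤ 1) (hb1 : b ≤ 1) (hc1 : c ≤ 1) (ht1 : t ≤ 1) (hu1 : u ≤ 1) (hf1 : f ≤ 1) :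
    1 + (a ^ 2 + b ^ 2 + c ^ 2 + t ^ 2 + u ^ 2 + f ^ 2) +
        2 * (a * b * t + a * u * c + b * f * c + t * f * u) +
        ((a * f) ^ 2 + (b * u) ^ 2 + (c * t) ^ 2) +
        2 * (a * t * f * c + a * u * f * b + b * t * u * c) ≤
      1 + (a + b + c + t + u + f) ^ 2 := by
  have tri {p q r : ℝ} (hp : 0 ≤ p) (hq : 0 ≤ q) (hr : 0 ≤ r) (hp1 : p ≤ 1) (hq1 : q ≤ 1)
      (hr1 : r ≤ 1) : 3 * (p * q * r) ≤ p * q + q * r + p * r := by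
    nlinarith [mul_nonneg (mul_nonneg hp hq) (sub_nonneg.2 hr1),
      mul_nonneg (mul_nonneg hp hr) (sub_nonneg.2 hq1),
      mul_nonneg (mul_nonneg hq hr) (sub_nonneg.2 hp1)]
  have sqr {p q : ℝ} (hp : 0 ≤ p) (hq : 0 ≤ q) (hp1 : p ≤ 1) (hq1 : q ≤ 1) :
      (p * q) ^ 2 ≤ p * q := by
    nlinarith [mul_nonneg hp hq, mul_le_one₀ hp1 hq hq1]
  have cyc {p q r s : ℝ} (hp : 0 ≤ p) (hq : 0 ≤ q) (hr : 0 ≤ r) (hs : 0 ≤ s) (hp1 : p ≤ 1)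
      (hq1 : q ≤ 1) (hr1 : r ≤ 1) (hs1 : s ≤ 1) :
      4 * (p * q * r * s) ≤ p * q + q * r + r * s + s * p := by
    nlinarith [mul_nonneg (mul_nonneg hp hq) (sub_nonneg.2 (mul_le_one₀ hr1 hs hs1)),
      mul_nonneg (mul_nonneg hr hs) (sub_nonneg.2 (mul_le_one₀ hp1 hq hq1)),
      mul_nonneg (mul_nonneg hq hr) (sub_nonneg.2 (mul_le_one₀ hs1 hp hp1)),
      mul_nonneg (mul_nonneg hs hp) (sub_nonneg.2 (mul_le_one₀ hq1 hr hr1))]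
  have adj : 0 ≤ a * b + a * t + b * t + a * u + a * c + u * c + b * f + b * c + f * c +
      t * f + t * u + f * u := by positivity
  have opp : 0 ≤ a * f + b * u + c * t := by positivity
  linarith [tri ha hb ht ha1 hb1 ht1, tri ha hu hc ha1 hu1 hc1, tri hb hf hc hb1 hf1 hc1,
    tri ht hf hu ht1 hf1 hu1, sqr ha hf ha1 hf1, sqr hb hu hb1 hu1, sqr hc ht hc1 ht1,
    cyc ha ht hf hc ha1 ht1 hf1 hc1, cyc ha hu hf hb ha1 hu1 hf1 hb1,
    cyc hb ht hu hc hb1 ht1 hu1 hc1]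

/-- Let `T` and `K` be the triangle and four-cycle contributions to the determinant and the
permanent of a `4 × 4` Hermitian matrix with unit diagonal and off-diagonal moduli
`a, b, c, t, u, f`. If the determinant is nonnegative, the square of the permanent is at least
`1 + S ^ 2`, where `S ≤ 2` is the sum of the squared moduli. -/
theorem one_add_sq_le_sq_of_det_nonneg {a b c t u f T K : ℝ}
    (ha : 0 ≤ a) (hf : 0 ≤ f)
    (hT : -(2 * (a * b * t + a * u * c + b * f * c + t * f * u)) ≤ T)
    (hK : -(2 * (a * t * f * c + a * u * f * b + b * t * u * c)) ≤ K)
    (hS : a ^ 2 + b ^ 2 + c ^ 2 + t ^ 2 + u ^ 2 + f ^ 2 ≤ 2)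
    (hdet : 0 ≤ 1 - (a ^ 2 + b ^ 2 + c ^ 2 + t ^ 2 + u ^ 2 + f ^ 2) + T +
      ((a * f) ^ 2 + (b * u) ^ 2 + (c * t) ^ 2) - K) :
    1 + (a ^ 2 + b ^ 2 + c ^ 2 + t ^ 2 + u ^ 2 + f ^ 2) ^ 2 ≤
      (1 + (a ^ 2 + b ^ 2 + c ^ 2 + t ^ 2 + u ^ 2 + f ^ 2) + T +
        ((a * f) ^ 2 + (b * u) ^ 2 + (c * t) ^ 2) + K) ^ 2 := by
  have hcyc := four_cycle_sum_le a b c t u f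
  have hP : a * t * f * c + a * u * f * b + b * t * u * c ≤
      (a * f) ^ 2 + (b * u) ^ 2 + (c * t) ^ 2 := by
    nlinarith [sq_nonneg (a * f - b * u), sq_nonneg (a * f - c * t), sq_nonneg (b * u - c * t)]
  have htri := triangle_sum_le (b := b) (c := c) (t := t) (u := u) ha hf
  have hS0 : 0 ≤ a ^ 2 + b ^ 2 + c ^ 2 + t ^ 2 + u ^ 2 + f ^ 2 := by positivity
  generalize a ^ 2 + b ^ 2 + c ^ 2 + t ^ 2 + u ^ 2 + f ^ 2 = S at *
  generalize (a * f) ^ 2 + (b * u) ^ 2 + (c * t) ^ 2 = P at *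
  rcases le_total S (27 / 32) with h | h
  · have hN : 1 + S * (1 / 2 - S / 12) ≤ 1 + S + T + P + K := by linarith [htri h]
    refine le_trans ?_ (pow_le_pow_left₀ (by nlinarith) hN 2)
    nlinarith [mul_nonneg hS0 (sub_nonneg.2 h), sq_nonneg (S * (1 / 2 - S / 12)),
      mul_nonneg (mul_nonneg hS0 hS0) (sub_nonneg.2 h)]
  · have hN : S * (2 - S / 3) ≤ 1 + S + T + P + K := by linarith
    refine le_trans ?_ (pow_le_pow_left₀ (by nlinarith) hN 2)
    have h2 : (4 / 3 : ℝ) ≤ 2 - S / 3 := by linarith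
    have h3 := mul_le_mul_of_nonneg_left h2 hS0
    rcases le_total S (27 / 20) with h' | h'
    · nlinarith [mul_nonneg (sub_nonneg.2 h) (sub_nonneg.2 h')]
    · nlinarith

theorem chollet_case_neg (x y z t u w : ℂ)
    (A : Matrix (Fin 4) (Fin 4) ℂ)
    (hAdef : A = !![1, x, y, z;
                    (starRingEnd ℂ) x, 1, t, u;
                    (starRingEnd ℂ) y, (starRingEnd ℂ) t, 1, w;
                    (starRingEnd ℂ) z, (starRingEnd ℂ) u, (starRingEnd ℂ) w, 1])
    (hA : A.PosSemidef)
    (hy1 : (0:ℝ) > (2 * (x * (starRingEnd ℂ) y * t).re))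
    (hy2 : (0:ℝ) > (2 * (x * u * (starRingEnd ℂ) z).re))
    (hy3 : (0:ℝ) > (2 * (y * w * (starRingEnd ℂ) z).re))
    (hy4 : (0:ℝ) > (2 * (t * w * (starRingEnd ℂ) u).re)) :
    (A ⊙ A.map (starRingEnd ℂ)).permanent ≤ A.permanent ^ 2 := by
  have hxyt : ‖x‖ ^ 2 + ‖y‖ ^ 2 + ‖t‖ ^ 2 ≤ 1 := by
    refine normSq_add_le_one_of_posSemidef ?_ (by linarith)
    convert hA.submatrix ![0, 1, 2]
    ext i j; fin_cases i <;> fin_cases j <;> simp [hAdef]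
  have hxzu : ‖x‖ ^ 2 + ‖z‖ ^ 2 + ‖u‖ ^ 2 ≤ 1 := by
    refine normSq_add_le_one_of_posSemidef ?_ (by rw [mul_right_comm]; linarith)
    convert hA.submatrix ![0, 1, 3]
    ext i j; fin_cases i <;> fin_cases j <;> simp [hAdef]
  have hyzw : ‖y‖ ^ 2 + ‖z‖ ^ 2 + ‖w‖ ^ 2 ≤ 1 := by
    refine normSq_add_le_one_of_posSemidef ?_ (by rw [mul_right_comm]; linarith)
    convert hA.submatrix ![0, 2, 3]
    ext i j; fin_cases i <;> fin_cases j <;> simp [hAdef]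
  have htuw : ‖t‖ ^ 2 + ‖u‖ ^ 2 + ‖w‖ ^ 2 ≤ 1 := by
    refine normSq_add_le_one_of_posSemidef ?_ (by rw [mul_right_comm]; linarith)
    convert hA.submatrix ![1, 2, 3]
    ext i j; fin_cases i <;> fin_cases j <;> simp [hAdef]
  set T : ℝ := 2 * ((x * (starRingEnd ℂ) y * t).re + (x * u * (starRingEnd ℂ) z).re +
    (y * w * (starRingEnd ℂ) z).re + (t * w * (starRingEnd ℂ) u).re) with hTdef
  set K : ℝ := 2 * ((x * t * w * (starRingEnd ℂ) z).re +
    (x * u * (starRingEnd ℂ) w * (starRingEnd ℂ) y).re +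
    (y * (starRingEnd ℂ) t * u * (starRingEnd ℂ) z).re) with hKdef
  have hdet : A.det = ((1 - (‖x‖ ^ 2 + ‖y‖ ^ 2 + ‖z‖ ^ 2 + ‖t‖ ^ 2 + ‖u‖ ^ 2 + ‖w‖ ^ 2) + T +
      ((‖x‖ * ‖w‖) ^ 2 + (‖y‖ * ‖u‖) ^ 2 + (‖z‖ * ‖t‖) ^ 2) - K : ℝ) : ℂ) := by
    simp only [hTdef, hKdef, mul_pow, ← Complex.normSq_eq_norm_sq, Complex.normSq_apply]
    simp only [hAdef, det_succ_row_zero, Fin.sum_univ_succ]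
    apply Complex.ext <;> simp [Fin.succAbove, pow_succ] <;> ring
  have hper : A.permanent =
      ((1 + (‖x‖ ^ 2 + ‖y‖ ^ 2 + ‖z‖ ^ 2 + ‖t‖ ^ 2 + ‖u‖ ^ 2 + ‖w‖ ^ 2) + T +
      ((‖x‖ * ‖w‖) ^ 2 + (‖y‖ * ‖u‖) ^ 2 + (‖z‖ * ‖t‖) ^ 2) + K : ℝ) : ℂ) := by
    simp only [hTdef, hKdef, mul_pow, ← Complex.normSq_eq_norm_sq, Complex.normSq_apply]
    rw [permanent_fin_four, hAdef]
    apply Complex.ext <;> simp <;> ring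
  have hper' : (A ⊙ A.map (starRingEnd ℂ)).permanent =
      ((1 + ((‖x‖ ^ 2) ^ 2 + (‖y‖ ^ 2) ^ 2 + (‖z‖ ^ 2) ^ 2 + (‖t‖ ^ 2) ^ 2 + (‖u‖ ^ 2) ^ 2 +
          (‖w‖ ^ 2) ^ 2) +
        2 * (‖x‖ ^ 2 * ‖y‖ ^ 2 * ‖t‖ ^ 2 + ‖x‖ ^ 2 * ‖u‖ ^ 2 * ‖z‖ ^ 2 +
          ‖y‖ ^ 2 * ‖w‖ ^ 2 * ‖z‖ ^ 2 + ‖t‖ ^ 2 * ‖w‖ ^ 2 * ‖u‖ ^ 2) +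
        ((‖x‖ ^ 2 * ‖w‖ ^ 2) ^ 2 + (‖y‖ ^ 2 * ‖u‖ ^ 2) ^ 2 + (‖z‖ ^ 2 * ‖t‖ ^ 2) ^ 2) +
        2 * (‖x‖ ^ 2 * ‖t‖ ^ 2 * ‖w‖ ^ 2 * ‖z‖ ^ 2 + ‖x‖ ^ 2 * ‖u‖ ^ 2 * ‖w‖ ^ 2 * ‖y‖ ^ 2 +
          ‖y‖ ^ 2 * ‖t‖ ^ 2 * ‖u‖ ^ 2 * ‖z‖ ^ 2) : ℝ) : ℂ) := by
    rw [permanent_fin_four, hAdef]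
    simp only [hadamard_apply, map_apply]
    simp [Complex.mul_conj, Complex.normSq_eq_conj_mul_self, ← Complex.conj_mul']
    ring
  have re_ge (v : ℂ) : -‖v‖ ≤ v.re := (abs_le.1 (Complex.abs_re_le_norm v)).1
  have hdet0 : 0 ≤ A.det := hA.det_nonneg
  rw [hdet, Complex.zero_le_real] at hdet0
  rw [hper, hper', ← Complex.ofReal_pow, Complex.real_le_real]
  refine (permanent_unit_diagonal_le (sq_nonneg _) (sq_nonneg _) (sq_nonneg _) (sq_nonneg _)
    (sq_nonneg _) (sq_nonneg _) ?_ ?_ ?_ ?_ ?_ ?_).trans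
    (one_add_sq_le_sq_of_det_nonneg (norm_nonneg x) (norm_nonneg w) ?_ ?_ (by linarith) hdet0)
  iterate 6 linarith [sq_nonneg ‖x‖, sq_nonneg ‖y‖, sq_nonneg ‖z‖, sq_nonneg ‖t‖, sq_nonneg ‖u‖,
      sq_nonneg ‖w‖]
  · have h1 := re_ge (x * (starRingEnd ℂ) y * t)
    have h2 := re_ge (x * u * (starRingEnd ℂ) z)
    have h3 := re_ge (y * w * (starRingEnd ℂ) z)
    have h4 := re_ge (t * w * (starRingEnd ℂ) u)
    simp only [norm_mul, Complex.norm_conj] at h1 h2 h3 h4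
    linarith
  · have h1 := re_ge (x * t * w * (starRingEnd ℂ) z)
    have h2 := re_ge (x * u * (starRingEnd ℂ) w * (starRingEnd ℂ) y)
    have h3 := re_ge (y * (starRingEnd ℂ) t * u * (starRingEnd ℂ) z)
    simp only [norm_mul, Complex.norm_conj] at h1 h2 h3
    linarith
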